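/- Let γ > 0, let γ′ > 1/2 + γ, and let c > 0. There exists a constant C > 0, depending only on γ, γ′ and c, such that for every ε ∈ (0,1] with c·ε ≤ 1/4, every T ≥ 0, and all measurable functions u, v : [0,T] × ℝ³ → ℝ satisfying |u(t,x)| ≤ √ε·(1+t+|q|)^{−(1−cε)}·(1+|q|)^{−γ′} and |v(t,x)| ≤ √ε·(1+t+|q|)^{−(1−cε)}·(1+|q|)^{−γ′} for all (t,x), where q = |x| − t, one has ∫₀^T ∫_{ℝ³} ((1+t)/ε)·u(t,x)²·v(t,x)²·w_γ(q) dx dt ≤ C·((1+T)^{4cε} − 1). -/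

import Mathlib

open MeasureTheory

noncomputable section

/-- The weight `w_γ` of the energy norm: `w_γ(q) = (1+|q|)^(1+2γ)` for `q > 0`
and `w_γ(q) = 1` for `q ≤ 0`. -/
def wWeight (γ : ℝ) (q : ℝ) : ℝ := if 0 < q then (1 + |q|) ^ (1 + 2 * γ) else 1

lemma wW_nonneg (γ q : ℝ) : 0 ≤ wWeight γ q := by
  unfold wWeight; split_ifs <;> positivity

lemma wW_le (γ q : ℝ) (hγ : 0 < γ) : wWeight γ q ≤ (1 + |q|) ^ (1 + 2 * γ) := by
  unfold wWeight; split_ifs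
  · exact le_rfl
  · exact Real.one_le_rpow (by linarith [abs_nonneg q]) (by linarith)

lemma pointwise_aux (γ γ' c ε t r U V : ℝ) (hγ : 0 < γ) (hγ' : 1 / 2 + γ < γ')
    (hε : 0 < ε) (ht : 0 ≤ t)
    (hU : |U| ≤ Real.sqrt ε * (1 + t + |r - t|) ^ (-(1 - c * ε)) * (1 + |r - t|) ^ (-γ'))
    (hV : |V| ≤ Real.sqrt ε * (1 + t + |r - t|) ^ (-(1 - c * ε)) * (1 + |r - t|) ^ (-γ')) :
    ((1 + t) / ε) * U ^ 2 * V ^ 2 * wWeight γ (r - t) ≤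
      ((1 + t) * ε) * ((1 + t + |r - t|) ^ (-4 + 4 * c * ε) * (1 + |r - t|) ^ (-(1 + 2 * γ))) := by
  have hq := abs_nonneg (r - t)
  have hp : 0 < 1 + t + |r - t| := by linarith
  have hs : 0 < 1 + |r - t| := by linarith
  have hs1 : 1 ≤ 1 + |r - t| := by linarith
  have hw := wW_le γ (r - t) hγ
  have hw0 := wW_nonneg γ (r - t)
  set w := wWeight γ (r - t)
  have e1 : (1 + t + |r - t|) ^ (-4 + 4 * c * ε) = ((1 + t + |r - t|) ^ (-(1 - c * ε))) ^ 4 := by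
    rw [← Real.rpow_natCast, ← Real.rpow_mul hp.le]; congr 1; push_cast; ring
  have e2 : ((1 + |r - t|) ^ (-γ')) ^ 4 * (1 + |r - t|) ^ (1 + 2 * γ)
      ≤ (1 + |r - t|) ^ (-(1 + 2 * γ)) := by
    rw [← Real.rpow_natCast, ← Real.rpow_mul hs.le, ← Real.rpow_add hs]
    apply Real.rpow_le_rpow_of_exponent_le hs1; push_cast; linarith
  have hA : 0 ≤ (1 + t + |r - t|) ^ (-(1 - c * ε)) := by positivity
  have hB : 0 ≤ (1 + |r - t|) ^ (-γ') := by positivity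
  rw [e1]
  set A := (1 + t + |r - t|) ^ (-(1 - c * ε))
  set B := (1 + |r - t|) ^ (-γ')
  have hsq : Real.sqrt ε ^ 2 = ε := Real.sq_sqrt hε.le
  have key : ∀ X : ℝ, |X| ≤ Real.sqrt ε * A * B → X ^ 2 ≤ ε * A ^ 2 * B ^ 2 := by
    intro X hX
    rw [← sq_abs, ← hsq, ← mul_pow, ← mul_pow]
    exact pow_le_pow_left₀ (abs_nonneg _) hX 2
  have hu := key U hU
  have hv := key V hV
  calc ((1 + t) / ε) * U ^ 2 * V ^ 2 * w
      ≤ ((1 + t) / ε) * (ε * A ^ 2 * B ^ 2) * (ε * A ^ 2 * B ^ 2) * (1 + |r - t|) ^ (1 + 2 * γ) := by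
        gcongr
    _ = ((1 + t) * ε) * (A ^ 4 * (B ^ 4 * (1 + |r - t|) ^ (1 + 2 * γ))) := by
        field_simp
    _ ≤ _ := by gcongr

lemma integrable_K (γ : ℝ) (hγ : 0 < γ) :
    Integrable (fun s : ℝ => (1 + |s|) ^ (-(1 + 2 * γ))) := by
  have := integrable_one_add_norm (E := ℝ) (μ := volume) (r := 1 + 2 * γ) (by simp; linarith)
  simpa using this

lemma radial_aux (γ a t r : ℝ) (ha : a ≤ 1) (ht : 0 ≤ t) (hr : 0 < r) :
    r ^ 2 * ((1 + t + |r - t|) ^ (-4 + a) * (1 + |r - t|) ^ (-(1 + 2 * γ)))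
      ≤ (1 + t) ^ (-2 + a) * (1 + |r - t|) ^ (-(1 + 2 * γ)) := by
  have hq := abs_nonneg (r - t)
  have hp : 0 < 1 + t + |r - t| := by linarith
  have h1 : r ≤ 1 + t + |r - t| := by linarith [le_abs_self (r - t)]
  have h2 : (1 + t + |r - t|) ^ (-2 + a) = (1 + t + |r - t|) ^ 2 * (1 + t + |r - t|) ^ (-4 + a) := by
    rw [← Real.rpow_natCast, ← Real.rpow_add hp]; congr 1; push_cast; ring
  have h3 : (1 + t + |r - t|) ^ (-2 + a) ≤ (1 + t) ^ (-2 + a) :=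
    Real.rpow_le_rpow_of_nonpos (by linarith) (by linarith) (by linarith)
  rw [← mul_assoc]
  gcongr
  refine le_trans ?_ h3
  rw [h2]
  gcongr

lemma cont_aux (γ a t : ℝ) (ht : 0 ≤ t) : Continuous
    (fun r : ℝ => (1 + t + |r - t|) ^ (-4 + a) * (1 + |r - t|) ^ (-(1 + 2 * γ))) := by
  apply Continuous.mul
  · exact Continuous.rpow_const (by fun_prop) (fun r => Or.inl (by positivity))
  · exact Continuous.rpow_const (by fun_prop) (fun r => Or.inl (by positivity))

lemma inner_aux (γ a t : ℝ) (hγ : 0 < γ) (ha : a ≤ 1) (ht : 0 ≤ t) :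
    Integrable (fun x : EuclideanSpace ℝ (Fin 3) =>
      (1 + t + |‖x‖ - t|) ^ (-4 + a) * (1 + |‖x‖ - t|) ^ (-(1 + 2 * γ))) ∧
    ∫ x : EuclideanSpace ℝ (Fin 3),
      (1 + t + |‖x‖ - t|) ^ (-4 + a) * (1 + |‖x‖ - t|) ^ (-(1 + 2 * γ))
      ≤ (3 * volume.real (Metric.ball (0 : EuclideanSpace ℝ (Fin 3)) 1)) *
        ((1 + t) ^ (-2 + a) * ∫ s : ℝ, (1 + |s|) ^ (-(1 + 2 * γ))) := by
  set f : ℝ → ℝ := fun r =>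
    (1 + t + |r - t|) ^ (-4 + a) * (1 + |r - t|) ^ (-(1 + 2 * γ)) with hf
  have hK : Integrable (fun r : ℝ => (1 + t) ^ (-2 + a) * (1 + |r - t|) ^ (-(1 + 2 * γ))) :=
    ((integrable_K γ hγ).comp_sub_right t).const_mul _
  have hI : IntegrableOn (fun r : ℝ => r ^ 2 * f r) (Set.Ioi 0) := by
    refine Integrable.mono' hK.integrableOn
      ((continuous_id.pow 2).mul (cont_aux γ a t ht)).aestronglyMeasurable ?_
    refine (ae_restrict_iff' measurableSet_Ioi).2 (Filter.Eventually.of_forall fun r hr => ?_)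
    have h0 : 0 ≤ r ^ 2 * f r := by simp only [hf]; positivity
    rw [Real.norm_of_nonneg h0]
    exact radial_aux γ a t r ha ht hr
  have hI2 : ∫ r in Set.Ioi (0:ℝ), r ^ 2 * f r
      ≤ (1 + t) ^ (-2 + a) * ∫ s : ℝ, (1 + |s|) ^ (-(1 + 2 * γ)) := by
    calc _ ≤ ∫ r in Set.Ioi (0:ℝ), (1 + t) ^ (-2 + a) * (1 + |r - t|) ^ (-(1 + 2 * γ)) :=
          setIntegral_mono_on hI hK.integrableOn measurableSet_Ioi
            fun r hr => radial_aux γ a t r ha ht hr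
      _ ≤ ∫ r : ℝ, (1 + t) ^ (-2 + a) * (1 + |r - t|) ^ (-(1 + 2 * γ)) :=
          setIntegral_le_integral hK (Filter.Eventually.of_forall fun r => by
            have : 0 ≤ 1 + t := by linarith
            simp only [Pi.zero_apply]; positivity)
      _ = _ := by
          rw [integral_const_mul,
            integral_sub_right_eq_self (fun s : ℝ => (1 + |s|) ^ (-(1 + 2 * γ))) t]
  constructor
  · refine (integrable_fun_norm_addHaar (f := f) volume).2 ?_
    simpa using hI
  · have := integral_fun_norm_addHaar (volume : Measure (EuclideanSpace ℝ (Fin 3))) f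
    simp only [finrank_euclideanSpace, Fintype.card_fin, nsmul_eq_mul, smul_eq_mul] at this
    rw [this]
    push_cast
    rw [← mul_assoc]
    gcongr

lemma time_aux (a T : ℝ) (ha : 0 < a) (hT : 0 ≤ T) :
    IntegrableOn (fun t : ℝ => (1 + t) ^ (-1 + a)) (Set.Icc 0 T) ∧
    ∫ t in Set.Icc (0 : ℝ) T, (1 + t) ^ (-1 + a) = ((1 + T) ^ a - 1) / a := by
  constructor
  · apply ContinuousOn.integrableOn_Icc
    apply ContinuousOn.rpow_const (by fun_prop)
    intro t ht
    have := ht.1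
    left; linarith
  · rw [integral_Icc_eq_integral_Ioc, ← intervalIntegral.integral_of_le hT,
      intervalIntegral.integral_comp_add_left (fun x : ℝ => x ^ (-1 + a)) 1,
      integral_rpow (Or.inl (by linarith))]
    simp

theorem bad_nonlinearity_phi_phi_estimate
    (γ γ' c : ℝ) (hγ : 0 < γ) (hγ' : 1 / 2 + γ < γ') (hc : 0 < c) :
    ∃ C > (0 : ℝ), ∀ ε : ℝ, 0 < ε → ε ≤ 1 → c * ε ≤ 1 / 4 → ∀ T : ℝ, 0 ≤ T →
      ∀ u v : ℝ × EuclideanSpace ℝ (Fin 3) → ℝ, Measurable u → Measurable v →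
      (∀ t ∈ Set.Icc (0 : ℝ) T, ∀ x : EuclideanSpace ℝ (Fin 3),
        |u (t, x)| ≤ Real.sqrt ε * (1 + t + |‖x‖ - t|) ^ (-(1 - c * ε))
          * (1 + |‖x‖ - t|) ^ (-γ')) →
      (∀ t ∈ Set.Icc (0 : ℝ) T, ∀ x : EuclideanSpace ℝ (Fin 3),
        |v (t, x)| ≤ Real.sqrt ε * (1 + t + |‖x‖ - t|) ^ (-(1 - c * ε))
          * (1 + |‖x‖ - t|) ^ (-γ')) →
      (∫ t in Set.Icc (0 : ℝ) T, ∫ x : EuclideanSpace ℝ (Fin 3),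
          ((1 + t) / ε) * u (t, x) ^ 2 * v (t, x) ^ 2 * wWeight γ (‖x‖ - t))
        ≤ C * ((1 + T) ^ (4 * c * ε) - 1) := by
  set K := ∫ s : ℝ, (1 + |s|) ^ (-(1 + 2 * γ)) with hKdef
  have hK : 0 ≤ K := integral_nonneg fun s => by simp only [Pi.zero_apply]; positivity
  set W := 3 * volume.real (Metric.ball (0 : EuclideanSpace ℝ (Fin 3)) 1) with hWdef
  have hW : 0 ≤ W := by positivity
  refine ⟨W * K / (4 * c) + 1, by positivity, ?_⟩
  intro ε hε _ hcε T hT u v _ _ hu hv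
  have ha : 0 < 4 * c * ε := by positivity
  have ha1 : 4 * c * ε ≤ 1 := by linarith
  obtain ⟨hti, hte⟩ := time_aux (4 * c * ε) T ha hT
  have hinner : ∀ t ∈ Set.Icc (0 : ℝ) T, (∫ x : EuclideanSpace ℝ (Fin 3),
      ((1 + t) / ε) * u (t, x) ^ 2 * v (t, x) ^ 2 * wWeight γ (‖x‖ - t))
      ≤ ε * W * K * (1 + t) ^ (-1 + 4 * c * ε) := by
    intro t ht
    have ht0 := ht.1
    have ht1 : 0 < 1 + t := by linarith
    obtain ⟨h1, h2⟩ := inner_aux γ (4 * c * ε) t hγ ha1 ht0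
    calc _ ≤ ∫ x : EuclideanSpace ℝ (Fin 3), ((1 + t) * ε) *
          ((1 + t + |‖x‖ - t|) ^ (-4 + 4 * c * ε) * (1 + |‖x‖ - t|) ^ (-(1 + 2 * γ))) := by
          refine integral_mono_of_nonneg (Filter.Eventually.of_forall fun x => ?_)
            (h1.const_mul _) (Filter.Eventually.of_forall fun x => ?_)
          · have := wW_nonneg γ (‖x‖ - t)
            simp only [Pi.zero_apply]; positivity
          · exact pointwise_aux γ γ' c ε t ‖x‖ _ _ hγ hγ' hε ht0 (hu t ht x) (hv t ht x)
      _ ≤ ((1 + t) * ε) * (W * ((1 + t) ^ (-2 + 4 * c * ε) * K)) := by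
          rw [integral_const_mul]
          gcongr
      _ = _ := by
          have : (1 + t) ^ (-1 + 4 * c * ε) = (1 + t) * (1 + t) ^ (-2 + 4 * c * ε) := by
            nth_rewrite 2 [← Real.rpow_one (1 + t)]
            rw [← Real.rpow_add ht1]; congr 1; ring
          rw [this]; ring
  have hmem : ∀ᵐ t ∂(volume.restrict (Set.Icc (0:ℝ) T)), t ∈ Set.Icc (0:ℝ) T :=
    ae_restrict_mem measurableSet_Icc
  have hge : 0 ≤ (1 + T) ^ (4 * c * ε) - 1 := by
    have := Real.one_le_rpow (show 1 ≤ 1 + T by linarith) ha.le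
    linarith
  calc _ ≤ ∫ t in Set.Icc (0 : ℝ) T, ε * W * K * (1 + t) ^ (-1 + 4 * c * ε) := by
        refine integral_mono_of_nonneg ?_ (hti.const_mul _) ?_
        · filter_upwards [hmem] with t ht
          refine integral_nonneg fun x => ?_
          have := wW_nonneg γ (‖x‖ - t)
          have := ht.1
          simp only [Pi.zero_apply]; positivity
        · filter_upwards [hmem] with t ht using hinner t ht
    _ = W * K / (4 * c) * ((1 + T) ^ (4 * c * ε) - 1) := by
        rw [integral_const_mul, hte]; field_simp
    _ ≤ _ := by gcongr; linarith

end
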